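/- For every β > 0 and h ∈ ℝ, the zero-replica limit and the infinite-volume limit of the interpolating function commute: both iterated limits lim_{N→∞} lim_{n→0⁺} φ_N(n,β,h) and lim_{n→0⁺} lim_{N→∞} φ_N(n,β,h) exist and lim_{N→∞} lim_{n→0⁺} φ_N(n,β,h) = lim_{n→0⁺} lim_{N→∞} φ_N(n,β,h) = α(β,h), where α(β,h) = lim_{N→∞} α_N(β,h). -/

import Mathlib

open MeasureTheory ProbabilityTheory Real Filter Topology

noncomputable section

/-- The ±1 spin value attached to a Boolean. -/
def spinVal (b : Bool) : ℝ := if b then 1 else -1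

/-- Law of the couplings `J = (J_{ij})`: i.i.d. standard Gaussians. -/
def skMuJ (N : ℕ) : Measure (Fin N × Fin N → ℝ) :=
  Measure.pi fun _ => gaussianReal 0 1

/-- The Sherrington–Kirkpatrick Hamiltonian. -/
def skH (N : ℕ) (h : ℝ) (J : Fin N × Fin N → ℝ) (σ : Fin N → Bool) : ℝ :=
  -(1 / Real.sqrt (N : ℝ)) *
      ∑ p ∈ Finset.univ.filter (fun p : Fin N × Fin N => p.1 < p.2),
        J p * spinVal (σ p.1) * spinVal (σ p.2)
    - h * ∑ i, spinVal (σ i)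

/-- The SK partition function. -/
def skZ (N : ℕ) (β h : ℝ) (J : Fin N × Fin N → ℝ) : ℝ :=
  ∑ σ : Fin N → Bool, Real.exp (-β * skH N h J σ)

/-- Quenched pressure `α_N(β,h) = N⁻¹ E log Z_N`. -/
def skAlpha (N : ℕ) (β h : ℝ) : ℝ :=
  (1 / (N : ℝ)) * ∫ J, Real.log (skZ N β h J) ∂ skMuJ N

/-- Interpolating function `φ_N(n,β,h) = (Nn)⁻¹ log E[Z_N^n]`. -/
def skPhi (N : ℕ) (n β h : ℝ) : ℝ :=
  (1 / ((N : ℝ) * n)) * Real.log (∫ J, skZ N β h J ^ n ∂ skMuJ N)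

/-- The standard Gaussian measure on `ι → ℝ`. -/
abbrev stdGaussianPi (ι : Type*) [Fintype ι] : Measure (ι → ℝ) :=
  Measure.pi fun _ => gaussianReal 0 1

lemma measurePreserving_update_stdGaussianPi {ι : Type*} [Fintype ι] [DecidableEq ι] (i : ι) :
    MeasurePreserving (fun p : (ι → ℝ) × ℝ => Function.update p.1 i p.2)
      ((stdGaussianPi ι).prod (gaussianReal 0 1)) (stdGaussianPi ι) := by
  have hm : Measurable (fun p : (ι → ℝ) × ℝ => Function.update p.1 i p.2) := by
    refine measurable_pi_lambda _ fun j => ?_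
    by_cases hj : j = i
    · subst hj; simpa using measurable_snd
    · simpa [hj, Function.comp_def] using (measurable_pi_apply j).comp (measurable_fst (α := ι → ℝ) (β := ℝ))
  refine ⟨hm, (Measure.pi_eq fun s hs => ?_).symm⟩
  rw [Measure.map_apply hm (MeasurableSet.univ_pi hs)]
  have : (fun p : (ι → ℝ) × ℝ => Function.update p.1 i p.2) ⁻¹' Set.pi Set.univ s
      = (Set.pi Set.univ (Function.update s i Set.univ)) ×ˢ s i := by
    ext ⟨g, x⟩
    simp only [Set.mem_preimage, Set.mem_pi, Set.mem_univ, true_implies, Set.mem_prod]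
    constructor
    · intro h
      refine ⟨fun j => ?_, by simpa using h i⟩
      by_cases hj : j = i
      · subst hj; simp
      · simpa [hj] using h j
    · rintro ⟨h, hx⟩ j
      by_cases hj : j = i
      · subst hj; simpa using hx
      · simpa [hj] using h j
  rw [this, Measure.prod_prod, Measure.pi_pi, ← Finset.mul_prod_erase _ _ (Finset.mem_univ i),
    ← Finset.mul_prod_erase Finset.univ (fun j => gaussianReal 0 1 (s j)) (Finset.mem_univ i)]
  simp only [Function.update_self, measure_univ, one_mul]
  rw [mul_comm]
  congr 1
  refine Finset.prod_congr rfl fun j hj => ?_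
  rw [Function.update_of_ne (Finset.ne_of_mem_erase hj)]

lemma integrable_exp_mul_abs_gaussianReal (K : ℝ) :
    Integrable (fun x => exp (K * |x|)) (gaussianReal 0 1) :=
  integrable_exp_mul_abs (X := id) (integrable_exp_mul_gaussianReal K)
    (integrable_exp_mul_gaussianReal (-K))

lemma integrable_exp_sum_abs {ι : Type*} [Fintype ι] (K : ℝ) :
    Integrable (fun g : ι → ℝ => exp (K * ∑ i, |g i|)) (stdGaussianPi ι) := by
  simp_rw [Finset.mul_sum, Real.exp_sum]
  exact Integrable.fintype_prod (f := fun _ x => exp (K * |x|))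
    fun _ => integrable_exp_mul_abs_gaussianReal K

lemma integrable_of_le_exp_sum_abs {ι : Type*} [Fintype ι] {F : (ι → ℝ) → ℝ} (hF : Measurable F)
    (C K : ℝ) (h : ∀ g, |F g| ≤ C * exp (K * ∑ i, |g i|)) :
    Integrable F (stdGaussianPi ι) :=
  ((integrable_exp_sum_abs K).const_mul C).mono' hF.aestronglyMeasurable
    (Eventually.of_forall h)

lemma integrable_of_le_exp_abs {f : ℝ → ℝ} (hf : Measurable f)
    (C K : ℝ) (h : ∀ x, |f x| ≤ C * exp (K * |x|)) :
    Integrable f (gaussianReal 0 1) :=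
  ((integrable_exp_mul_abs_gaussianReal K).const_mul C).mono' hf.aestronglyMeasurable
    (Eventually.of_forall h)

lemma hasDerivAt_gaussianPDFReal (x : ℝ) :
    HasDerivAt (gaussianPDFReal 0 1) (-x * gaussianPDFReal 0 1 x) x := by
  unfold gaussianPDFReal
  have h : HasDerivAt (fun y : ℝ => -(y - 0) ^ 2 / (2 * ((1 : NNReal) : ℝ))) (-x) x := by
    have := (((hasDerivAt_id x).sub_const 0).pow 2).neg.div_const (2 * ((1 : NNReal) : ℝ))
    refine this.congr_deriv ?_
    simp only [id, NNReal.coe_one]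
    push_cast
    ring
  refine (h.exp.const_mul _).congr_deriv ?_
  ring

/-- Integration by parts for the one-dimensional standard Gaussian. -/
lemma integral_id_mul_gaussianReal {f f' : ℝ → ℝ} (hd : ∀ x, HasDerivAt f (f' x) x)
    (hf : Integrable f (gaussianReal 0 1)) (hf' : Integrable f' (gaussianReal 0 1))
    (hxf : Integrable (fun x => x * f x) (gaussianReal 0 1)) :
    ∫ x, x * f x ∂gaussianReal 0 1 = ∫ x, f' x ∂gaussianReal 0 1 := by
  have key : ∀ u : ℝ → ℝ, Integrable u (gaussianReal 0 1) →
      Integrable (fun x => u x * gaussianPDFReal 0 1 x) := by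
    intro u hu
    rw [gaussianReal_of_var_ne_zero 0 one_ne_zero] at hu
    rw [integrable_withDensity_iff_integrable_smul' (measurable_gaussianPDF 0 1)
      (Eventually.of_forall fun _ => gaussianPDF_lt_top)] at hu
    refine hu.congr (Eventually.of_forall fun x => ?_)
    simp [toReal_gaussianPDF, mul_comm]
  have h0 := integral_mul_deriv_eq_deriv_mul_of_integrable (u := f) (v := gaussianPDFReal 0 1)
    (u' := f') (v' := fun x => -x * gaussianPDFReal 0 1 x)
    (fun x _ => hd x) (fun x _ => hasDerivAt_gaussianPDFReal x)
    (by
      refine (key _ hxf).neg.congr (Eventually.of_forall fun x => ?_)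
      simp only [Pi.neg_apply, Pi.mul_apply]; ring)
    (key _ hf') (key _ hf)
  rw [integral_gaussianReal_eq_integral_smul one_ne_zero,
    integral_gaussianReal_eq_integral_smul one_ne_zero]
  simp only [smul_eq_mul]
  have e1 : ∀ x, gaussianPDFReal 0 1 x * (x * f x) = -(f x * (-x * gaussianPDFReal 0 1 x)) :=
    fun x => by ring
  simp_rw [e1, integral_neg, h0, neg_neg]
  exact integral_congr_ae (Eventually.of_forall fun x => mul_comm _ _)

lemma integral_update_stdGaussianPi {ι : Type*} [Fintype ι] [DecidableEq ι] (i : ι)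
    {G : (ι → ℝ) → ℝ} (hG : Integrable G (stdGaussianPi ι)) :
    ∫ g, ∫ x, G (Function.update g i x) ∂gaussianReal 0 1 ∂stdGaussianPi ι
      = ∫ g, G g ∂stdGaussianPi ι := by
  have T := measurePreserving_update_stdGaussianPi i
  have h2 : Integrable (G ∘ fun p : (ι → ℝ) × ℝ => Function.update p.1 i p.2)
      ((stdGaussianPi ι).prod (gaussianReal 0 1)) :=
    T.integrable_comp_of_integrable hG
  refine (Eq.trans ?_ (integral_prod _ h2)).symm
  conv_lhs => rw [← T.map_eq]
  rw [integral_map T.measurable.aemeasurable]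
  · rfl
  · rw [T.map_eq]; exact hG.1

/-- Integration by parts for the standard Gaussian on `ι → ℝ`. -/
lemma integral_coord_mul_stdGaussianPi {ι : Type*} [Fintype ι] [DecidableEq ι] (i : ι)
    {F F' : (ι → ℝ) → ℝ}
    (hd : ∀ g x, HasDerivAt (fun y => F (Function.update g i y)) (F' (Function.update g i x)) x)
    (hF : Integrable F (stdGaussianPi ι)) (hF' : Integrable F' (stdGaussianPi ι))
    (hxF : Integrable (fun g => g i * F g) (stdGaussianPi ι)) :
    ∫ g, g i * F g ∂stdGaussianPi ι = ∫ g, F' g ∂stdGaussianPi ι := by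
  have T := measurePreserving_update_stdGaussianPi i
  have sec : ∀ {G : (ι → ℝ) → ℝ}, Integrable G (stdGaussianPi ι) →
      ∀ᵐ g ∂stdGaussianPi ι,
        Integrable (fun x => G (Function.update g i x)) (gaussianReal 0 1) := fun hG =>
    (T.integrable_comp_of_integrable hG).prod_right_ae
  rw [← integral_update_stdGaussianPi i hxF, ← integral_update_stdGaussianPi i hF']
  refine integral_congr_ae ?_
  filter_upwards [sec hF, sec hF', sec hxF] with g h1 h2 h3
  simp only [Function.update_self] at h3 ⊢
  exact integral_id_mul_gaussianReal (hd g) h1 h2 h3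

lemma integral_exp_mul_gaussianReal (c : ℝ) :
    ∫ x, exp (c * x) ∂gaussianReal 0 1 = exp (c ^ 2 / 2) := by
  have := congrFun (mgf_id_gaussianReal (μ := 0) (v := 1)) c
  simpa [mgf] using this

/-- Exponential moment bound for Lipschitz functions of one Gaussian variable. -/
lemma integral_exp_le_of_lipschitz_gaussianReal {f : ℝ → ℝ} {l : ℝ}
    (hf : ∀ x y, |f x - f y| ≤ l * |x - y|) :
    ∫ x, exp (f x) ∂gaussianReal 0 1 ≤ exp (∫ x, f x ∂gaussianReal 0 1 + l ^ 2) := by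
  have hl : 0 ≤ l := by simpa using (abs_nonneg _).trans (hf 1 0)
  have hc : Continuous f := by
    refine (LipschitzWith.of_dist_le_mul (K := ⟨l, hl⟩) fun x y => ?_).continuous
    rw [Real.dist_eq, Real.dist_eq]
    exact hf x y
  have hb : ∀ x, |f x| ≤ |f 0| + l * |x| := fun x => by
    have h1 := hf x 0
    rw [sub_zero] at h1
    have h2 := abs_add_le (f x - f 0) (f 0)
    rw [sub_add_cancel] at h2
    linarith
  have hbe : ∀ x, exp |f x| ≤ exp |f 0| * exp (l * |x|) := fun x => by
    rw [← exp_add]; exact exp_le_exp.2 (hb x)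
  have i0 : Integrable f (gaussianReal 0 1) :=
    integrable_of_le_exp_abs hc.measurable _ _ fun x =>
      ((by linarith [add_one_le_exp |f x|] : |f x| ≤ exp |f x|)).trans (hbe x)
  have i1 : Integrable (fun x => exp (f x)) (gaussianReal 0 1) :=
    integrable_of_le_exp_abs (by fun_prop) _ _ fun x => by
      rw [abs_of_pos (exp_pos _)]
      exact (exp_le_exp.2 (le_abs_self _)).trans (hbe x)
  have i2 : Integrable (fun x => exp (-f x)) (gaussianReal 0 1) :=
    integrable_of_le_exp_abs (by fun_prop) _ _ fun x => by
      rw [abs_of_pos (exp_pos _)]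
      exact (exp_le_exp.2 (neg_le_abs _)).trans (hbe x)
  have jensen : exp (-∫ x, f x ∂gaussianReal 0 1) ≤ ∫ x, exp (-f x) ∂gaussianReal 0 1 := by
    rw [← integral_neg]
    exact convexOn_exp.map_integral_le (f := fun x => -f x) continuous_exp.continuousOn
      isClosed_univ (by simp) i0.neg i2
  have e1 : (∫ x, exp (f x) ∂gaussianReal 0 1) * ∫ x, exp (-f x) ∂gaussianReal 0 1
      = ∫ p, exp (f p.1 - f p.2) ∂(gaussianReal 0 1).prod (gaussianReal 0 1) := by
    rw [← integral_prod_mul]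
    simp_rw [← exp_add, sub_eq_add_neg]
  have e2 : (∫ x, exp (f x) ∂gaussianReal 0 1) * ∫ x, exp (-f x) ∂gaussianReal 0 1
      = ∫ p, exp (-(f p.1 - f p.2)) ∂(gaussianReal 0 1).prod (gaussianReal 0 1) := by
    rw [mul_comm, ← integral_prod_mul]
    simp_rw [← exp_add]
    refine integral_congr_ae (Eventually.of_forall fun p => ?_)
    simp only; ring_nf
  have e3 : exp (l ^ 2) = ∫ p, exp (l * (p.1 - p.2)) ∂(gaussianReal 0 1).prod (gaussianReal 0 1) := by
    have := integral_prod_mul (μ := gaussianReal 0 1) (ν := gaussianReal 0 1)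
      (fun x : ℝ => exp (l * x)) (fun x => exp (-l * x))
    rw [integral_exp_mul_gaussianReal, integral_exp_mul_gaussianReal, ← exp_add] at this
    rw [show l ^ 2 = l ^ 2 / 2 + (-l) ^ 2 / 2 by ring, ← this]
    simp_rw [← exp_add]
    refine integral_congr_ae (Eventually.of_forall fun p => ?_)
    simp only; ring_nf
  have e4 : exp (l ^ 2)
      = ∫ p, exp (-(l * (p.1 - p.2))) ∂(gaussianReal 0 1).prod (gaussianReal 0 1) := by
    have := integral_prod_mul (μ := gaussianReal 0 1) (ν := gaussianReal 0 1)
      (fun x : ℝ => exp (-l * x)) (fun x => exp (l * x))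
    rw [integral_exp_mul_gaussianReal, integral_exp_mul_gaussianReal, ← exp_add] at this
    rw [show l ^ 2 = (-l) ^ 2 / 2 + l ^ 2 / 2 by ring, ← this]
    simp_rw [← exp_add]
    refine integral_congr_ae (Eventually.of_forall fun p => ?_)
    simp only; ring_nf
  have j1 : Integrable (fun p : ℝ × ℝ => exp (f p.1 - f p.2))
      ((gaussianReal 0 1).prod (gaussianReal 0 1)) := by
    simpa only [← exp_add, ← sub_eq_add_neg] using i1.mul_prod i2
  have j2 : Integrable (fun p : ℝ × ℝ => exp (-(f p.1 - f p.2)))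
      ((gaussianReal 0 1).prod (gaussianReal 0 1)) := by
    refine (i2.mul_prod i1).congr (Eventually.of_forall fun p => ?_)
    simp only [← exp_add]; ring_nf
  have j3 : Integrable (fun p : ℝ × ℝ => exp (l * (p.1 - p.2)))
      ((gaussianReal 0 1).prod (gaussianReal 0 1)) := by
    refine ((integrable_exp_mul_gaussianReal l).mul_prod
      (integrable_exp_mul_gaussianReal (-l))).congr (Eventually.of_forall fun p => ?_)
    simp only [← exp_add]; ring_nf
  have j4 : Integrable (fun p : ℝ × ℝ => exp (-(l * (p.1 - p.2))))
      ((gaussianReal 0 1).prod (gaussianReal 0 1)) := by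
    refine ((integrable_exp_mul_gaussianReal (-l)).mul_prod
      (integrable_exp_mul_gaussianReal l)).congr (Eventually.of_forall fun p => ?_)
    simp only [← exp_add]; ring_nf
  have mono : ∫ p, (exp (f p.1 - f p.2) + exp (-(f p.1 - f p.2)))
        ∂(gaussianReal 0 1).prod (gaussianReal 0 1)
      ≤ ∫ p, (exp (l * (p.1 - p.2)) + exp (-(l * (p.1 - p.2))))
        ∂(gaussianReal 0 1).prod (gaussianReal 0 1) := by
    refine integral_mono (j1.add j2) (j3.add j4) fun p => ?_
    have := Real.cosh_le_cosh (x := f p.1 - f p.2) (y := l * (p.1 - p.2)) |>.2 (by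
      rw [abs_mul, abs_of_nonneg hl]; exact hf _ _)
    rw [Real.cosh_eq, Real.cosh_eq] at this
    simp only
    linarith
  rw [integral_add j1 j2, integral_add j3 j4, ← e1, ← e2, ← e3, ← e4] at mono
  have hpos : 0 ≤ ∫ x, exp (f x) ∂gaussianReal 0 1 := integral_nonneg fun _ => (exp_pos _).le
  have h1 := mul_le_mul_of_nonneg_left jensen hpos
  have h2 : (∫ x, exp (f x) ∂gaussianReal 0 1) * exp (-∫ x, f x ∂gaussianReal 0 1)
      ≤ exp (l ^ 2) := by linarith
  have h3 := mul_le_mul_of_nonneg_right h2 (exp_pos (∫ x, f x ∂gaussianReal 0 1)).le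
  rw [mul_assoc, ← exp_add, neg_add_cancel, exp_zero, mul_one, ← exp_add] at h3
  rwa [add_comm]

section CoordLipschitz

variable {ι : Type*} [Fintype ι] {F : (ι → ℝ) → ℝ} {l : ι → ℝ}

lemma continuous_of_coord_lipschitz (hF : ∀ x y, |F x - F y| ≤ ∑ i, l i * |x i - y i|) :
    Continuous F := by
  refine continuous_iff_continuousAt.2 fun y => ?_
  refine tendsto_iff_dist_tendsto_zero.2 ?_
  refine squeeze_zero (fun _ => dist_nonneg) (g := fun x => ∑ i, l i * |x i - y i|)
    (fun x => by rw [Real.dist_eq]; exact hF x y) ?_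
  have : Continuous fun x : ι → ℝ => ∑ i, l i * |x i - y i| := by fun_prop
  simpa using this.tendsto y

lemma exp_abs_le_of_coord_lipschitz (hF : ∀ x y, |F x - F y| ≤ ∑ i, l i * |x i - y i|)
    (hl : ∀ i, 0 ≤ l i) (g : ι → ℝ) :
    exp |F g| ≤ exp |F 0| * exp ((∑ i, l i) * ∑ i, |g i|) := by
  rw [← exp_add]
  refine exp_le_exp.2 ?_
  have h1 := hF g 0
  have h2 := abs_add_le (F g - F 0) (F 0)
  rw [sub_add_cancel] at h2
  have h3 : ∑ i, l i * |g i - (0 : ι → ℝ) i| ≤ (∑ i, l i) * ∑ i, |g i| := by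
    rw [Finset.sum_mul]
    refine Finset.sum_le_sum fun i _ => mul_le_mul_of_nonneg_left ?_ (hl i)
    simpa using Finset.single_le_sum (f := fun i => |g i|) (fun j _ => abs_nonneg _)
      (Finset.mem_univ i)
  linarith

lemma integrable_of_coord_lipschitz (hF : ∀ x y, |F x - F y| ≤ ∑ i, l i * |x i - y i|)
    (hl : ∀ i, 0 ≤ l i) : Integrable F (stdGaussianPi ι) :=
  integrable_of_le_exp_sum_abs (continuous_of_coord_lipschitz hF).measurable _ _ fun g =>
    (by linarith [add_one_le_exp |F g|] : |F g| ≤ exp |F g|).trans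
      (exp_abs_le_of_coord_lipschitz hF hl g)

lemma integrable_exp_of_coord_lipschitz (hF : ∀ x y, |F x - F y| ≤ ∑ i, l i * |x i - y i|)
    (hl : ∀ i, 0 ≤ l i) : Integrable (fun g => exp (F g)) (stdGaussianPi ι) :=
  integrable_of_le_exp_sum_abs (continuous_of_coord_lipschitz hF).rexp.measurable _ _ fun g => by
    rw [abs_of_pos (exp_pos _)]
    exact (exp_le_exp.2 (le_abs_self _)).trans (exp_abs_le_of_coord_lipschitz hF hl g)

/-- Exponential moment bound for functions that are Lipschitz in each of finitely many
independent standard Gaussian variables. -/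
lemma integral_exp_le_of_coord_lipschitz (hF : ∀ x y, |F x - F y| ≤ ∑ i, l i * |x i - y i|)
    (hl : ∀ i, 0 ≤ l i) :
    ∫ g, exp (F g) ∂stdGaussianPi ι ≤ exp (∫ g, F g ∂stdGaussianPi ι + ∑ i, l i ^ 2) := by
  classical
  suffices H : ∀ (s : Finset ι) (F : (ι → ℝ) → ℝ) (l : ι → ℝ),
      (∀ x y, |F x - F y| ≤ ∑ i, l i * |x i - y i|) → (∀ i, 0 ≤ l i) → (∀ i ∉ s, l i = 0) →
      ∫ g, exp (F g) ∂stdGaussianPi ι ≤ exp (∫ g, F g ∂stdGaussianPi ι + ∑ i ∈ s, l i ^ 2) from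
    H Finset.univ F l hF hl (by simp)
  intro s
  induction s using Finset.induction_on with
  | empty =>
    intro F l hF hl h0
    have : ∀ g, F g = F 0 := fun g => by
      have := hF g 0
      simp only [h0 _ (Finset.notMem_empty _), zero_mul, Finset.sum_const_zero] at this
      exact sub_eq_zero.1 (abs_nonpos_iff.1 this)
    simp_rw [this]
    simp
  | insert i s his ih =>
    intro F l hF hl h0
    have iF := integrable_of_coord_lipschitz hF hl
    have ieF := integrable_exp_of_coord_lipschitz hF hl
    have hsec : ∀ g x y, |F (Function.update g i x) - F (Function.update g i y)|
        ≤ l i * |x - y| := fun g x y => by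
      refine (hF _ _).trans (le_of_eq ?_)
      rw [Finset.sum_eq_single i]
      · simp
      · intro j _ hj; simp [hj]
      · simp
    have isec : ∀ g, Integrable (fun x => F (Function.update g i x)) (gaussianReal 0 1) :=
      fun g => by
        have hc : Continuous fun x => F (Function.update g i x) :=
          (continuous_of_coord_lipschitz hF).comp (continuous_const.update i continuous_id)
        refine integrable_of_le_exp_abs hc.measurable (exp |F (Function.update g i 0)|) (l i)
          fun x => ?_
        rw [← exp_add]
        have h1 := hsec g x 0
        rw [sub_zero] at h1
        have h2 := abs_add_le (F (Function.update g i x) - F (Function.update g i 0))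
          (F (Function.update g i 0))
        rw [sub_add_cancel] at h2
        linarith [add_one_le_exp (|F (Function.update g i 0)| + l i * |x|)]
    set G : (ι → ℝ) → ℝ := fun g => ∫ x, F (Function.update g i x) ∂gaussianReal 0 1 with hG
    have hGl : ∀ x y, |G x - G y| ≤ ∑ j, Function.update l i 0 j * |x j - y j| := fun x y => by
      rw [hG]
      simp only
      rw [← integral_sub (isec x) (isec y)]
      have := norm_integral_le_of_norm_le_const (μ := gaussianReal 0 1)
        (f := fun a => F (Function.update x i a) - F (Function.update y i a))
        (C := ∑ j, Function.update l i 0 j * |x j - y j|)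
        (Eventually.of_forall fun a => by
          rw [Real.norm_eq_abs]
          refine (hF _ _).trans (Finset.sum_le_sum fun j _ => ?_)
          by_cases hj : j = i
          · subst hj; simp
          · simp [hj])
      simpa using this
    have hl' : ∀ j, 0 ≤ Function.update l i 0 j := fun j => by
      by_cases hj : j = i
      · subst hj; simp
      · simpa [hj] using hl j
    have h0' : ∀ j ∉ s, Function.update l i 0 j = 0 := fun j hjs => by
      by_cases hj : j = i
      · subst hj; simp
      · simpa [hj] using h0 j (by simp [hj, hjs])
    have key := ih G (Function.update l i 0) hGl hl' h0'
    have hGi : ∫ g, G g ∂stdGaussianPi ι = ∫ g, F g ∂stdGaussianPi ι :=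
      integral_update_stdGaussianPi i iF
    rw [hGi] at key
    rw [← integral_update_stdGaussianPi i ieF]
    have step : ∫ g, ∫ x, exp (F (Function.update g i x)) ∂gaussianReal 0 1 ∂stdGaussianPi ι
        ≤ ∫ g, exp (l i ^ 2) * exp (G g) ∂stdGaussianPi ι := by
      refine integral_mono_of_nonneg
        (Eventually.of_forall fun g => integral_nonneg fun _ => (exp_pos _).le)
        ((integrable_exp_of_coord_lipschitz hGl hl').const_mul _)
        (Eventually.of_forall fun g => ?_)
      simp only
      rw [← exp_add, add_comm]
      exact integral_exp_le_of_lipschitz_gaussianReal (hsec g)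
    refine step.trans ?_
    rw [integral_const_mul, Finset.sum_insert his]
    refine (mul_le_mul_of_nonneg_left key (exp_pos _).le).trans (le_of_eq ?_)
    rw [← exp_add]
    congr 1
    have : ∑ j ∈ s, Function.update l i 0 j ^ 2 = ∑ j ∈ s, l j ^ 2 :=
      Finset.sum_congr rfl fun j hj => by
        rw [Function.update_of_ne (by rintro rfl; exact his hj)]
    rw [this]; ring

end CoordLipschitz

section Interpolation

variable {ι S : Type*} [Fintype ι] [Fintype S]

/-- The sum over `s` of `u s` times the Boltzmann weight `exp (c s + ∑ i, w i s * g i)`. -/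
def boltzmannSum (c : S → ℝ) (w : ι → S → ℝ) (u : S → ℝ) (g : ι → ℝ) : ℝ :=
  ∑ s, u s * exp (c s + ∑ i, w i s * g i)

lemma continuous_boltzmannSum (c : S → ℝ) (w : ι → S → ℝ) (u : S → ℝ) :
    Continuous (boltzmannSum c w u) := by
  unfold boltzmannSum; fun_prop

lemma boltzmannSum_one_pos [Nonempty S] (c : S → ℝ) (w : ι → S → ℝ) (g : ι → ℝ) :
    0 < boltzmannSum c w 1 g :=
  Finset.sum_pos (fun s _ => by simpa using exp_pos _) Finset.univ_nonempty

lemma continuous_boltzmannSum_one_rpow [Nonempty S] (c : S → ℝ) (w : ι → S → ℝ) (r : ℝ) :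
    Continuous fun g => boltzmannSum c w 1 g ^ r :=
  (continuous_boltzmannSum c w 1).rpow_const fun g => Or.inl (boltzmannSum_one_pos c w g).ne'

lemma abs_boltzmannSum_le (c : S → ℝ) (w : ι → S → ℝ) {u : S → ℝ} {U : ℝ} (hu : ∀ s, |u s| ≤ U)
    (g : ι → ℝ) : |boltzmannSum c w u g| ≤ U * boltzmannSum c w 1 g := by
  unfold boltzmannSum
  rw [Finset.mul_sum]
  refine (Finset.abs_sum_le_sum_abs _ _).trans (Finset.sum_le_sum fun s _ => ?_)
  rw [abs_mul, abs_of_pos (exp_pos _), Pi.one_apply, one_mul]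
  exact mul_le_mul_of_nonneg_right (hu s) (exp_pos _).le

lemma boltzmannSum_one_rpow_le [Nonempty S] {c : S → ℝ} {w : ι → S → ℝ} {C V n : ℝ}
    (hC : ∀ s, |c s| ≤ C) (hV : ∀ i s, |w i s| ≤ V) (h0 : 0 ≤ n) (h1 : n ≤ 1) (g : ι → ℝ) :
    boltzmannSum c w 1 g ^ n ≤ Fintype.card S * exp C * exp (V * ∑ i, |g i|) := by
  have hB : boltzmannSum c w 1 g ≤ Fintype.card S * exp C * exp (V * ∑ i, |g i|) := by
    unfold boltzmannSum
    rw [mul_assoc, ← nsmul_eq_mul]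
    refine Finset.sum_le_card_nsmul _ _ _ fun s _ => ?_
    rw [Pi.one_apply, one_mul, ← exp_add]
    refine exp_le_exp.2 (add_le_add ((le_abs_self _).trans (hC s)) ?_)
    rw [Finset.mul_sum]
    refine Finset.sum_le_sum fun i _ => (le_abs_self _).trans ?_
    rw [abs_mul]
    exact mul_le_mul_of_nonneg_right (hV i s) (abs_nonneg _)
  have hB1 : 1 ≤ Fintype.card S * exp C * exp (V * ∑ i, |g i|) := by
    obtain ⟨s⟩ := ‹Nonempty S›
    have hC0 : 0 ≤ C := (abs_nonneg _).trans (hC s)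
    have hcard : (1 : ℝ) ≤ Fintype.card S := by exact_mod_cast Fintype.card_pos_iff.2 ⟨s⟩
    have hVs : 0 ≤ V * ∑ i, |g i| := by
      rw [Finset.mul_sum]
      exact Finset.sum_nonneg fun i _ =>
        mul_nonneg ((abs_nonneg _).trans (hV i s)) (abs_nonneg _)
    exact one_le_mul_of_one_le_of_one_le
      (one_le_mul_of_one_le_of_one_le hcard (one_le_exp hC0)) (one_le_exp hVs)
  calc boltzmannSum c w 1 g ^ n
      ≤ (Fintype.card S * exp C * exp (V * ∑ i, |g i|)) ^ n :=
        rpow_le_rpow (boltzmannSum_one_pos c w g).le hB h0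
    _ ≤ (Fintype.card S * exp C * exp (V * ∑ i, |g i|)) ^ (1 : ℝ) :=
        rpow_le_rpow_of_exponent_le hB1 h1
    _ = _ := rpow_one _

lemma abs_coord_le_exp_sum_abs (g : ι → ℝ) (i : ι) : |g i| ≤ exp (∑ j, |g j|) := by
  have := Finset.single_le_sum (f := fun j => |g j|) (fun j _ => abs_nonneg _) (Finset.mem_univ i)
  linarith [add_one_le_exp (∑ j, |g j|)]

lemma rpow_sub_one_mul_abs_le {Z a U n : ℝ} (hZ : 0 < Z) (ha : |a| ≤ U * Z) :
    |Z ^ (n - 1) * a| ≤ U * Z ^ n := by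
  rw [abs_mul, abs_of_pos (rpow_pos_of_pos hZ _)]
  refine (mul_le_mul_of_nonneg_left ha (rpow_pos_of_pos hZ _).le).trans (le_of_eq ?_)
  rw [rpow_sub_one hZ.ne']
  field_simp

lemma rpow_sub_two_mul_abs_le {Z a b U n V : ℝ} (hZ : 0 < Z) (ha : |a| ≤ U * Z)
    (hb : |b| ≤ V * Z) : |Z ^ (n - 2) * (a * b)| ≤ U * V * Z ^ n := by
  rw [abs_mul, abs_mul, abs_of_pos (rpow_pos_of_pos hZ _)]
  refine (mul_le_mul_of_nonneg_left (mul_le_mul ha hb (abs_nonneg _)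
    ((abs_nonneg _).trans ha)) (rpow_pos_of_pos hZ _).le).trans (le_of_eq ?_)
  rw [show n - 2 = n - (2 : ℕ) by norm_num, rpow_sub_natCast hZ.ne']
  field_simp

lemma hasDerivAt_boltzmannSum_update [DecidableEq ι] (c : S → ℝ) (w : ι → S → ℝ) (u : S → ℝ)
    (g : ι → ℝ) (i : ι) (x : ℝ) :
    HasDerivAt (fun y => boltzmannSum c w u (Function.update g i y))
      (boltzmannSum c w (u * w i) (Function.update g i x)) x := by
  unfold boltzmannSum
  refine HasDerivAt.fun_sum fun s _ => ?_
  have hlin : HasDerivAt (fun y => c s + ∑ j, w j s * Function.update g i y j) (w i s) x := by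
    refine HasDerivAt.const_add _ ?_
    have : HasDerivAt (fun y => ∑ j, w j s * Function.update g i y j)
        (∑ j, if j = i then w j s else 0) x := by
      refine HasDerivAt.fun_sum fun j _ => ?_
      by_cases hj : j = i
      · subst hj
        simpa using (hasDerivAt_id x).const_mul (w j s)
      · simpa [hj] using hasDerivAt_const x (w j s * g j)
    simpa using this
  refine (hlin.exp.const_mul (u s)).congr_deriv ?_
  simp only [Pi.mul_apply]; ring

lemma sum_mul_boltzmannSum_sq_le {c : S → ℝ} {w v : ι → S → ℝ} {ε : ι → ℝ} {k : ℝ}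
    (hD : ∀ s s', ∑ i, ε i * (v i s * v i s') ≤ k) (g : ι → ℝ) :
    ∑ i, ε i * boltzmannSum c w (v i) g ^ 2 ≤ k * boltzmannSum c w 1 g ^ 2 := by
  have e : ∑ i, ε i * boltzmannSum c w (v i) g ^ 2
      = ∑ s, ∑ s', (∑ i, ε i * (v i s * v i s')) *
        (exp (c s + ∑ i, w i s * g i) * exp (c s' + ∑ i, w i s' * g i)) := by
    simp_rw [boltzmannSum, sq, Finset.sum_mul_sum, Finset.mul_sum, Finset.sum_mul]
    rw [Finset.sum_comm]
    refine Finset.sum_congr rfl fun s _ => ?_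
    rw [Finset.sum_comm]
    refine Finset.sum_congr rfl fun s' _ => Finset.sum_congr rfl fun i _ => ?_
    ring
  have e' : k * boltzmannSum c w 1 g ^ 2
      = ∑ s, ∑ s', k *
        (exp (c s + ∑ i, w i s * g i) * exp (c s' + ∑ i, w i s' * g i)) := by
    simp_rw [boltzmannSum, sq, Finset.sum_mul_sum, Finset.mul_sum, Pi.one_apply, one_mul]
  rw [e, e']
  exact Finset.sum_le_sum fun s _ => Finset.sum_le_sum fun s' _ =>
    mul_le_mul_of_nonneg_right (hD s s') (by positivity)

lemma sum_mul_boltzmannSum_mul_self {c : S → ℝ} {w v : ι → S → ℝ} {ε : ι → ℝ} {k : ℝ}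
    (hD : ∀ s, ∑ i, ε i * (v i s * v i s) = k) (g : ι → ℝ) :
    ∑ i, ε i * boltzmannSum c w (v i * v i) g = k * boltzmannSum c w 1 g := by
  simp_rw [boltzmannSum, Finset.mul_sum]
  rw [Finset.sum_comm]
  refine Finset.sum_congr rfl fun s _ => ?_
  rw [← hD s, Pi.one_apply, one_mul, Finset.sum_mul]
  refine Finset.sum_congr rfl fun i _ => ?_
  simp only [Pi.mul_apply]; ring

lemma boltzmannSum_smul (c : S → ℝ) (w : ι → S → ℝ) (u : S → ℝ) (r : ℝ) (g : ι → ℝ) :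
    boltzmannSum c w (fun s => r * u s) g = r * boltzmannSum c w u g := by
  simp_rw [boltzmannSum, Finset.mul_sum, mul_assoc]

lemma hasDerivAt_boltzmannSum_scale (c : S → ℝ) (v : ι → S → ℝ) {a a' : ι → ℝ → ℝ}
    (ha : ∀ i t, HasDerivAt (a i) (a' i t) t) (g : ι → ℝ) (t : ℝ) :
    HasDerivAt (fun t => boltzmannSum c (fun i s => a i t * v i s) 1 g)
      (∑ i, a' i t * (g i * boltzmannSum c (fun i s => a i t * v i s) (v i) g)) t := by
  have h : HasDerivAt (fun t => boltzmannSum c (fun i s => a i t * v i s) 1 g)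
      (∑ s, 1 * (exp (c s + ∑ i, a i t * v i s * g i) * ∑ i, a' i t * v i s * g i)) t := by
    unfold boltzmannSum
    refine HasDerivAt.fun_sum fun s _ => ((HasDerivAt.const_add _ ?_).exp.const_mul _)
    exact HasDerivAt.fun_sum fun i _ => ((ha i t).mul_const _).mul_const _
  refine h.congr_deriv ?_
  simp_rw [boltzmannSum, Finset.mul_sum]
  rw [Finset.sum_comm]
  refine Finset.sum_congr rfl fun i _ => Finset.sum_congr rfl fun s _ => ?_
  ring

variable [Nonempty S] {c : S → ℝ} {w : ι → S → ℝ} {C V n : ℝ}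

lemma integrable_rpow_mul_boltzmannSum (hC : ∀ s, |c s| ≤ C) (hV : ∀ i s, |w i s| ≤ V)
    (h0 : 0 ≤ n) (h1 : n ≤ 1) (u : S → ℝ) :
    Integrable (fun g => boltzmannSum c w 1 g ^ (n - 1) * boltzmannSum c w u g)
      (stdGaussianPi ι) := by
  refine integrable_of_le_exp_sum_abs ((continuous_boltzmannSum_one_rpow c w (n - 1)).mul
    (continuous_boltzmannSum c w u)).measurable ((∑ s, |u s|) * (Fintype.card S * exp C)) V
    fun g => ?_
  have hu : ∀ s, |u s| ≤ ∑ s, |u s| := fun s =>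
    Finset.single_le_sum (f := fun s => |u s|) (fun j _ => abs_nonneg _) (Finset.mem_univ s)
  refine (rpow_sub_one_mul_abs_le (boltzmannSum_one_pos c w g)
    (abs_boltzmannSum_le c w hu g)).trans ?_
  rw [mul_assoc]
  exact mul_le_mul_of_nonneg_left (boltzmannSum_one_rpow_le hC hV h0 h1 g)
    (Finset.sum_nonneg fun _ _ => abs_nonneg _)

lemma integrable_coord_mul_rpow_mul_boltzmannSum (hC : ∀ s, |c s| ≤ C) (hV : ∀ i s, |w i s| ≤ V)
    (h0 : 0 ≤ n) (h1 : n ≤ 1) (u : S → ℝ) (i : ι) :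
    Integrable (fun g => g i * (boltzmannSum c w 1 g ^ (n - 1) * boltzmannSum c w u g))
      (stdGaussianPi ι) := by
  refine integrable_of_le_exp_sum_abs ((continuous_apply i).mul
    ((continuous_boltzmannSum_one_rpow c w (n - 1)).mul
    (continuous_boltzmannSum c w u))).measurable ((∑ s, |u s|) * (Fintype.card S * exp C)) (1 + V)
    fun g => ?_
  have hu : ∀ s, |u s| ≤ ∑ s, |u s| := fun s =>
    Finset.single_le_sum (f := fun s => |u s|) (fun j _ => abs_nonneg _) (Finset.mem_univ s)
  rw [abs_mul, add_mul, one_mul, exp_add]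
  refine (mul_le_mul (abs_coord_le_exp_sum_abs g i) ((rpow_sub_one_mul_abs_le
    (boltzmannSum_one_pos c w g) (abs_boltzmannSum_le c w hu g)).trans
    (mul_le_mul_of_nonneg_left (boltzmannSum_one_rpow_le hC hV h0 h1 g)
    (Finset.sum_nonneg fun _ _ => abs_nonneg _))) (abs_nonneg _) (exp_pos _).le).trans
    (le_of_eq ?_)
  ring

lemma integrable_rpow_mul_boltzmannSum_mul (hC : ∀ s, |c s| ≤ C) (hV : ∀ i s, |w i s| ≤ V)
    (h0 : 0 ≤ n) (h1 : n ≤ 1) (u u' : S → ℝ) :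
    Integrable (fun g => boltzmannSum c w 1 g ^ (n - 2) *
      (boltzmannSum c w u g * boltzmannSum c w u' g)) (stdGaussianPi ι) := by
  refine integrable_of_le_exp_sum_abs ((continuous_boltzmannSum_one_rpow c w (n - 2)).mul
    ((continuous_boltzmannSum c w u).mul (continuous_boltzmannSum c w u'))).measurable
    ((∑ s, |u s|) * (∑ s, |u' s|) * (Fintype.card S * exp C)) V fun g => ?_
  have hu : ∀ u : S → ℝ, ∀ s, |u s| ≤ ∑ s, |u s| := fun u s =>
    Finset.single_le_sum (f := fun s => |u s|) (fun j _ => abs_nonneg _) (Finset.mem_univ s)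
  refine (rpow_sub_two_mul_abs_le (boltzmannSum_one_pos c w g)
    (abs_boltzmannSum_le c w (hu u) g) (abs_boltzmannSum_le c w (hu u') g)).trans ?_
  rw [mul_assoc _ (_ * exp C)]
  exact mul_le_mul_of_nonneg_left (boltzmannSum_one_rpow_le hC hV h0 h1 g)
    (mul_nonneg (Finset.sum_nonneg fun _ _ => abs_nonneg _)
      (Finset.sum_nonneg fun _ _ => abs_nonneg _))

/-- Gaussian integration by parts for Boltzmann sums. -/
lemma integral_coord_mul_rpow_mul_boltzmannSum (hC : ∀ s, |c s| ≤ C) (hV : ∀ i s, |w i s| ≤ V)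
    (h0 : 0 ≤ n) (h1 : n ≤ 1) (u : S → ℝ) (i : ι) :
    ∫ g, g i * (boltzmannSum c w 1 g ^ (n - 1) * boltzmannSum c w u g) ∂stdGaussianPi ι
      = ∫ g, ((n - 1) * (boltzmannSum c w 1 g ^ (n - 2) *
            (boltzmannSum c w (w i) g * boltzmannSum c w u g))
          + boltzmannSum c w 1 g ^ (n - 1) * boltzmannSum c w (u * w i) g)
          ∂stdGaussianPi ι := by
  classical
  refine integral_coord_mul_stdGaussianPi i (fun g x => ?_)
    (integrable_rpow_mul_boltzmannSum hC hV h0 h1 u)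
    (((integrable_rpow_mul_boltzmannSum_mul hC hV h0 h1 (w i) u).const_mul _).add
      (integrable_rpow_mul_boltzmannSum hC hV h0 h1 (u * w i)))
    (integrable_coord_mul_rpow_mul_boltzmannSum hC hV h0 h1 u i)
  have d1 := (hasDerivAt_boltzmannSum_update c w 1 g i x).rpow_const (p := n - 1)
    (Or.inl (boltzmannSum_one_pos c w _).ne')
  refine (d1.mul (hasDerivAt_boltzmannSum_update c w u g i x)).congr_deriv ?_
  rw [one_mul, show n - 1 - 1 = n - 2 by ring]
  ring

/-- Gaussian interpolation: if the covariance increments `∑ i, ε i * (v i s * v i s')` are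
constant and nonnegative on the diagonal and bounded by the diagonal value, then fractional
moments of the partition function increase along the path. -/
lemma monotoneOn_integral_boltzmannSum_rpow {v : ι → S → ℝ} {a a' : ι → ℝ → ℝ} {ε : ι → ℝ}
    {ρ : ℝ → ℝ} {k T : ℝ}
    (ha : ∀ i t, HasDerivAt (a i) (a' i t) t) (hab : ∀ i t, |a i t| ≤ 1)
    (hab' : ∀ i t, |a' i t| ≤ 1) (haa : ∀ i t, a i t * a' i t = ρ t * ε i)
    (hρ : ∀ t ∈ Set.Icc 0 T, 0 ≤ ρ t) (hk : 0 ≤ k)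
    (hD : ∀ s, ∑ i, ε i * (v i s * v i s) = k)
    (hD' : ∀ s s', ∑ i, ε i * (v i s * v i s') ≤ k) (h0 : 0 ≤ n) (h1 : n ≤ 1) :
    MonotoneOn (fun t => ∫ g, boltzmannSum c (fun i s => a i t * v i s) 1 g ^ n ∂stdGaussianPi ι)
      (Set.Icc 0 T) := by
  set Z : ℝ → (ι → ℝ) → ℝ := fun t => boltzmannSum c (fun i s => a i t * v i s) 1 with hZ
  have hZpos : ∀ t g, 0 < Z t g := fun t g => boltzmannSum_one_pos _ _ _
  obtain ⟨C, hC⟩ : ∃ C, ∀ s, |c s| ≤ C :=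
    ⟨∑ s, |c s|, fun s => Finset.single_le_sum (f := fun s => |c s|)
      (fun j _ => abs_nonneg _) (Finset.mem_univ s)⟩
  obtain ⟨V, hV0, hV⟩ : ∃ V, 0 ≤ V ∧ ∀ i s, |v i s| ≤ V := by
    refine ⟨∑ i, ∑ s, |v i s|, Finset.sum_nonneg fun _ _ => Finset.sum_nonneg fun _ _ =>
      abs_nonneg _, fun i s => ?_⟩
    exact (Finset.single_le_sum (f := fun s => |v i s|) (fun j _ => abs_nonneg _)
      (Finset.mem_univ s)).trans (Finset.single_le_sum (f := fun i => ∑ s, |v i s|)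
      (fun j _ => Finset.sum_nonneg fun _ _ => abs_nonneg _) (Finset.mem_univ i))
  have hw : ∀ t i s, |a i t * v i s| ≤ V := fun t i s => by
    rw [abs_mul]
    exact (mul_le_mul (hab i t) (hV i s) (abs_nonneg _) zero_le_one).trans_eq (one_mul V)
  have hcont : ∀ t, Continuous fun g => Z t g ^ n := fun t =>
    continuous_boltzmannSum_one_rpow _ _ _
  have hint : ∀ t, Integrable (fun g => Z t g ^ n) (stdGaussianPi ι) := fun t =>
    integrable_of_le_exp_sum_abs (hcont t).measurable _ _ fun g => by
      rw [abs_of_pos (rpow_pos_of_pos (hZpos t g) n)]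
      exact boltzmannSum_one_rpow_le hC (hw t) h0 h1 g
  set D : ℝ → (ι → ℝ) → ℝ := fun t g => ∑ i, n * a' i t * (g i * (Z t g ^ (n - 1) *
    boltzmannSum c (fun i s => a i t * v i s) (v i) g)) with hDdef
  have hderiv : ∀ g t, HasDerivAt (fun t => Z t g ^ n) (D t g) t := fun g t => by
    refine ((hasDerivAt_boltzmannSum_scale c v ha g t).rpow_const (p := n)
      (Or.inl (hZpos t g).ne')).congr_deriv ?_
    rw [hDdef, Finset.sum_mul, Finset.sum_mul]
    refine Finset.sum_congr rfl fun i _ => ?_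
    ring
  have hDint : ∀ t i, Integrable (fun g => n * a' i t * (g i * (Z t g ^ (n - 1) *
      boltzmannSum c (fun i s => a i t * v i s) (v i) g))) (stdGaussianPi ι) := fun t i =>
    (integrable_coord_mul_rpow_mul_boltzmannSum hC (hw t) h0 h1 (v i) i).const_mul _
  have hbound : ∀ g t, ‖D t g‖ ≤ ∑ _i : ι, V * (Fintype.card S * exp C) *
      exp ((1 + V) * ∑ j, |g j|) := fun g t => by
    rw [Real.norm_eq_abs, hDdef]
    refine (Finset.abs_sum_le_sum_abs _ _).trans (Finset.sum_le_sum fun i _ => ?_)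
    rw [abs_mul, abs_mul (g i), abs_mul n]
    have b1 : |n| * |a' i t| ≤ 1 :=
      mul_le_one₀ (by rwa [abs_of_nonneg h0]) (abs_nonneg _) (hab' i t)
    have b2 := (rpow_sub_one_mul_abs_le (n := n) (hZpos t g)
      (abs_boltzmannSum_le c (fun i s => a i t * v i s) (hV i) g)).trans
      (mul_le_mul_of_nonneg_left (boltzmannSum_one_rpow_le hC (hw t) h0 h1 g) hV0)
    refine (mul_le_mul b1 (mul_le_mul (abs_coord_le_exp_sum_abs g i) b2 (abs_nonneg _)
      (exp_pos _).le) (by positivity) zero_le_one).trans (le_of_eq ?_)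
    rw [add_mul 1 V, one_mul (∑ j, |g j|), exp_add]
    ring
  have hmain : ∀ t, HasDerivAt (fun t => ∫ g, Z t g ^ n ∂stdGaussianPi ι)
      (∫ g, D t g ∂stdGaussianPi ι) t := fun t =>
    (hasDerivAt_integral_of_dominated_loc_of_deriv_le (s := Set.univ) Filter.univ_mem
      (Eventually.of_forall fun t => (hcont t).aestronglyMeasurable) (hint t)
      (integrable_finsetSum _ fun i _ => hDint t i).aestronglyMeasurable
      (Eventually.of_forall fun g t _ => hbound g t)
      (integrable_finsetSum _ fun i _ => (integrable_exp_sum_abs (1 + V)).const_mul _)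
      (Eventually.of_forall fun g t _ => hderiv g t)).2
  refine monotoneOn_of_deriv_nonneg (convex_Icc 0 T)
    (fun t _ => (hmain t).continuousAt.continuousWithinAt)
    (fun t _ => (hmain t).differentiableAt.differentiableWithinAt) fun t ht => ?_
  rw [(hmain t).deriv]
  have ht' := hρ t (interior_subset ht)
  have hibp : ∫ g, D t g ∂stdGaussianPi ι
      = ∫ g, ∑ i, n * a' i t * ((n - 1) * (Z t g ^ (n - 2) *
          (boltzmannSum c (fun i s => a i t * v i s) (fun s => a i t * v i s) g *
            boltzmannSum c (fun i s => a i t * v i s) (v i) g))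
        + Z t g ^ (n - 1) * boltzmannSum c (fun i s => a i t * v i s)
            (v i * fun s => a i t * v i s) g) ∂stdGaussianPi ι := by
    rw [hDdef, integral_finsetSum _ fun i _ => hDint t i, integral_finsetSum]
    · refine Finset.sum_congr rfl fun i _ => ?_
      rw [integral_const_mul, integral_const_mul]
      congr 1
      exact integral_coord_mul_rpow_mul_boltzmannSum hC (hw t) h0 h1 (v i) i
    · intro i _
      exact (((integrable_rpow_mul_boltzmannSum_mul hC (hw t) h0 h1 _ _).const_mul _).add
        (integrable_rpow_mul_boltzmannSum hC (hw t) h0 h1 _)).const_mul _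
  rw [hibp]
  refine integral_nonneg fun g => ?_
  have e1 : ∀ i, boltzmannSum c (fun i s => a i t * v i s) (v i * fun s => a i t * v i s) g
      = a i t * boltzmannSum c (fun i s => a i t * v i s) (v i * v i) g := fun i => by
    rw [← boltzmannSum_smul]
    congr 1
    ext s; simp only [Pi.mul_apply]; ring
  simp_rw [boltzmannSum_smul, e1]
  have hq := sum_mul_boltzmannSum_sq_le (c := c) (w := fun i s => a i t * v i s) hD' g
  have hl := sum_mul_boltzmannSum_mul_self (c := c) (w := fun i s => a i t * v i s) hD g
  set B : ι → ℝ := fun i => boltzmannSum c (fun i s => a i t * v i s) (v i) g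
  set B2 : ι → ℝ := fun i => boltzmannSum c (fun i s => a i t * v i s) (v i * v i) g
  have hz := hZpos t g
  have e2 : Z t g ^ (n - 1) = Z t g ^ (n - 2) * Z t g := by
    rw [show n - 1 = n - 2 + 1 by ring, rpow_add_one hz.ne']
  have e3 : ∑ i, n * a' i t * ((n - 1) * (Z t g ^ (n - 2) * (a i t * B i * B i))
      + Z t g ^ (n - 1) * (a i t * B2 i))
      = n * ρ t * Z t g ^ (n - 2) *
        (Z t g * (∑ i, ε i * B2 i) - (1 - n) * ∑ i, ε i * B i ^ 2) := by
    rw [Finset.mul_sum, Finset.mul_sum, ← Finset.sum_sub_distrib, Finset.mul_sum]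
    refine Finset.sum_congr rfl fun i _ => ?_
    rw [e2]
    linear_combination (n * ((n - 1) * (Z t g ^ (n - 2) * (B i * B i))
      + Z t g ^ (n - 2) * Z t g * B2 i)) * haa i t
  change (0 : ℝ) ≤ ∑ i, n * a' i t * ((n - 1) * (Z t g ^ (n - 2) * (a i t * B i * B i))
      + Z t g ^ (n - 1) * (a i t * B2 i))
  rw [e3]
  refine mul_nonneg (mul_nonneg (mul_nonneg h0 ht') (rpow_pos_of_pos hz _).le) ?_
  have h3 := mul_le_mul_of_nonneg_left hq (sub_nonneg.2 h1)
  rw [hl]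
  have h4 : 0 ≤ n * (k * Z t g ^ 2) := by positivity
  nlinarith [h3, h4]

end Interpolation

/-- Comparison of fractional moments of two Gaussian partition functions. -/
lemma integral_boltzmannSum_rpow_le {ι κ S : Type*} [Fintype ι] [Fintype κ] [Fintype S] [Nonempty S]
    {c : S → ℝ} {v : ι → S → ℝ} {v' : κ → S → ℝ} {k n : ℝ} (hk : 0 ≤ k)
    (hD : ∀ s, ∑ i, v i s * v i s - ∑ j, v' j s * v' j s = k)
    (hD' : ∀ s s', ∑ i, v i s * v i s' - ∑ j, v' j s * v' j s' ≤ k) (h0 : 0 ≤ n) (h1 : n ≤ 1) :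
    ∫ g, boltzmannSum c v' 1 g ^ n ∂stdGaussianPi κ
      ≤ ∫ g, boltzmannSum c v 1 g ^ n ∂stdGaussianPi ι := by
  have mono := monotoneOn_integral_boltzmannSum_rpow (c := c) (v := Sum.elim v v')
    (a := Sum.elim (fun _ : ι => sin) (fun _ : κ => cos))
    (a' := Sum.elim (fun _ : ι => cos) (fun _ : κ => fun t => -sin t))
    (ε := Sum.elim (fun _ => 1) (fun _ => -1)) (ρ := fun t => sin t * cos t) (k := k)
    (T := π / 2) (n := n)
    (by rintro (i | j) t
        · exact hasDerivAt_sin t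
        · exact hasDerivAt_cos t)
    (by rintro (i | j) t
        · exact abs_sin_le_one t
        · exact abs_cos_le_one t)
    (by rintro (i | j) t
        · exact abs_cos_le_one t
        · simpa using abs_sin_le_one t)
    (by rintro (i | j) t
        · simp
        · simp [mul_comm])
    (fun t ht => mul_nonneg
      (sin_nonneg_of_nonneg_of_le_pi ht.1 (by linarith [ht.2, pi_pos]))
      (cos_nonneg_of_neg_pi_div_two_le_of_le (by linarith [ht.1, pi_pos]) ht.2))
    hk (fun s => by simpa [Fintype.sum_sum_type, sub_eq_add_neg] using hD s)
    (fun s s' => by simpa [Fintype.sum_sum_type, sub_eq_add_neg] using hD' s s') h0 h1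
  have hle := mono (Set.left_mem_Icc.2 (by positivity)) (Set.right_mem_Icc.2 (by positivity))
    (by positivity : (0 : ℝ) ≤ π / 2)
  have hmp := measurePreserving_sumPiEquivProdPi (fun _ : ι ⊕ κ => gaussianReal 0 1)
  have fst : ∀ F : (ι → ℝ) → ℝ, ∫ g, F (fun i => g (Sum.inl i)) ∂stdGaussianPi (ι ⊕ κ)
      = ∫ g, F g ∂stdGaussianPi ι := fun F => by
    have := hmp.integral_comp' (fun p : (ι → ℝ) × (κ → ℝ) => F p.1)
    refine this.trans ?_
    rw [integral_fun_fst]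
    simp
  have snd : ∀ F : (κ → ℝ) → ℝ, ∫ g, F (fun i => g (Sum.inr i)) ∂stdGaussianPi (ι ⊕ κ)
      = ∫ g, F g ∂stdGaussianPi κ := fun F => by
    have := hmp.integral_comp' (fun p : (ι → ℝ) × (κ → ℝ) => F p.2)
    refine this.trans ?_
    rw [integral_fun_snd]
    simp
  rw [← fst, ← snd]
  simpa [boltzmannSum, Fintype.sum_sum_type] using hle

lemma spinVal_mul_self (b : Bool) : spinVal b * spinVal b = 1 := by
  cases b <;> simp [spinVal]

lemma abs_spinVal (b : Bool) : |spinVal b| = 1 := by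
  cases b <;> simp [spinVal]

/-- The coefficient of the coupling `J p` in `-β` times the SK Hamiltonian. -/
def skCoef (N : ℕ) (β : ℝ) (p : Fin N × Fin N) (σ : Fin N → Bool) : ℝ :=
  if p.1 < p.2 then β / Real.sqrt N * (spinVal (σ p.1) * spinVal (σ p.2)) else 0

/-- The external field term in `-β` times the SK Hamiltonian. -/
def skField (N : ℕ) (β h : ℝ) (σ : Fin N → Bool) : ℝ := β * h * ∑ i, spinVal (σ i)

lemma neg_mul_skH (N : ℕ) (β h : ℝ) (J : Fin N × Fin N → ℝ) (σ : Fin N → Bool) :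
    -β * skH N h J σ = skField N β h σ + ∑ p, skCoef N β p σ * J p := by
  simp only [skH, skField, skCoef, ite_mul, zero_mul]
  rw [← Finset.sum_filter, mul_sub]
  have : ∑ p : Fin N × Fin N with p.1 < p.2,
        β / √N * (spinVal (σ p.1) * spinVal (σ p.2)) * J p
      = β / √N * ∑ p : Fin N × Fin N with p.1 < p.2,
        J p * spinVal (σ p.1) * spinVal (σ p.2) := by
    rw [Finset.mul_sum]
    exact Finset.sum_congr rfl fun p _ => by ring
  rw [this]
  ring

lemma skZ_eq_boltzmannSum (N : ℕ) (β h : ℝ) (J : Fin N × Fin N → ℝ) :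
    skZ N β h J = boltzmannSum (skField N β h) (skCoef N β) 1 J := by
  simp only [skZ, boltzmannSum, neg_mul_skH, Pi.one_apply, one_mul]

lemma sum_lt_mul_eq {N : ℕ} (τ : Fin N → ℝ) (hτ : ∀ i, τ i * τ i = 1) :
    ∑ p : Fin N × Fin N, (if p.1 < p.2 then τ p.1 * τ p.2 else 0) = ((∑ i, τ i) ^ 2 - N) / 2 := by
  rw [Fintype.sum_prod_type]
  have h1 : (∑ i, τ i) ^ 2 = ∑ i, ∑ j, ((if i < j then τ i * τ j else 0)
      + (if j < i then τ i * τ j else 0) + if i = j then τ i * τ j else 0) := by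
    rw [sq, Finset.sum_mul_sum]
    refine Finset.sum_congr rfl fun i _ => Finset.sum_congr rfl fun j _ => ?_
    rcases lt_trichotomy i j with h | h | h
    · simp [h, h.not_gt, h.ne]
    · simp [h]
    · simp [h, h.not_gt, h.ne']
  have h2 : ∑ i, ∑ j, (if j < i then τ i * τ j else 0)
      = ∑ i, ∑ j, (if i < j then τ i * τ j else 0) := by
    rw [Finset.sum_comm]
    exact Finset.sum_congr rfl fun i _ => Finset.sum_congr rfl fun j _ => by rw [mul_comm]
  simp only [Finset.sum_add_distrib, h2, Finset.sum_ite_eq, Finset.mem_univ, if_true, hτ,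
    Finset.sum_const, Finset.card_univ, Fintype.card_fin, nsmul_eq_mul, mul_one] at h1
  rw [h1]
  ring

/-- Covariance of the SK Gaussian field in terms of the overlap. -/
lemma sum_skCoef_mul_skCoef {N : ℕ} (hN : N ≠ 0) (β : ℝ) (σ σ' : Fin N → Bool) :
    ∑ p, skCoef N β p σ * skCoef N β p σ'
      = β ^ 2 / 2 * ((∑ i, spinVal (σ i) * spinVal (σ' i)) ^ 2 / N - 1) := by
  have hN' : (N : ℝ) ≠ 0 := by exact_mod_cast hN
  have h := sum_lt_mul_eq (fun i => spinVal (σ i) * spinVal (σ' i)) fun i => by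
    rw [mul_mul_mul_comm, spinVal_mul_self, spinVal_mul_self, one_mul]
  have e : ∀ p, skCoef N β p σ * skCoef N β p σ' = β ^ 2 / N *
      (if p.1 < p.2 then (spinVal (σ p.1) * spinVal (σ' p.1)) *
        (spinVal (σ p.2) * spinVal (σ' p.2)) else 0) := fun p => by
    unfold skCoef
    split_ifs
    · have : (√(N : ℝ)) ^ 2 = N := sq_sqrt (Nat.cast_nonneg N)
      rw [← this, sqrt_sq (sqrt_nonneg _)]
      ring
    · simp
  simp_rw [e]
  rw [← Finset.mul_sum, h]
  field_simp

lemma sum_spinVal_mul_self {N : ℕ} (σ : Fin N → Bool) :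
    ∑ i, spinVal (σ i) * spinVal (σ i) = N := by
  simp [spinVal_mul_self]

lemma skZ_pos (N : ℕ) (β h : ℝ) (J : Fin N × Fin N → ℝ) : 0 < skZ N β h J := by
  rw [skZ_eq_boltzmannSum]; exact boltzmannSum_one_pos _ _ _

/-- Superadditivity of the fractional moments of the SK partition function. -/
lemma integral_skZ_rpow_mul_le {m k : ℕ} (hm : m ≠ 0) (hk : k ≠ 0) (β h : ℝ) {n : ℝ} (h0 : 0 ≤ n)
    (h1 : n ≤ 1) :
    (∫ J, skZ m β h J ^ n ∂skMuJ m) * ∫ J, skZ k β h J ^ n ∂skMuJ k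
      ≤ ∫ J, skZ (m + k) β h J ^ n ∂skMuJ (m + k) := by
  have hm' : (0 : ℝ) < m := by positivity
  have hk' : (0 : ℝ) < k := by positivity
  have cov : ∀ σ σ' : Fin (m + k) → Bool,
      ∑ p, skCoef (m + k) β p σ * skCoef (m + k) β p σ' -
        ∑ q, (Sum.elim (fun p (σ : Fin (m + k) → Bool) => skCoef m β p (σ ∘ Fin.castAdd k))
          (fun p σ => skCoef k β p (σ ∘ Fin.natAdd m)) q σ) *
          (Sum.elim (fun p (σ : Fin (m + k) → Bool) => skCoef m β p (σ ∘ Fin.castAdd k))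
          (fun p σ => skCoef k β p (σ ∘ Fin.natAdd m)) q σ')
      = β ^ 2 / 2 * (1 + (∑ i, spinVal (σ (Fin.castAdd k i)) * spinVal (σ' (Fin.castAdd k i))
          + ∑ i, spinVal (σ (Fin.natAdd m i)) * spinVal (σ' (Fin.natAdd m i))) ^ 2 / (m + k)
        - (∑ i, spinVal (σ (Fin.castAdd k i)) * spinVal (σ' (Fin.castAdd k i))) ^ 2 / m
        - (∑ i, spinVal (σ (Fin.natAdd m i)) * spinVal (σ' (Fin.natAdd m i))) ^ 2 / k) := by
    intro σ σ'
    rw [Fintype.sum_sum_type]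
    simp only [Sum.elim_inl, Sum.elim_inr]
    rw [sum_skCoef_mul_skCoef (by omega), sum_skCoef_mul_skCoef hm, sum_skCoef_mul_skCoef hk,
      Fin.sum_univ_add]
    simp only [Function.comp_apply]
    push_cast
    ring
  have key := integral_boltzmannSum_rpow_le (c := skField (m + k) β h) (v := skCoef (m + k) β)
    (v' := Sum.elim (fun p (σ : Fin (m + k) → Bool) => skCoef m β p (σ ∘ Fin.castAdd k))
          (fun p σ => skCoef k β p (σ ∘ Fin.natAdd m))) (k := β ^ 2 / 2) (n := n)
    (by positivity)
    (fun σ => by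
      rw [cov, sum_spinVal_mul_self fun i => σ (Fin.castAdd k i),
        sum_spinVal_mul_self fun i => σ (Fin.natAdd m i)]
      field_simp
      ring)
    (fun σ σ' => by
      rw [cov]
      set a := ∑ i, spinVal (σ (Fin.castAdd k i)) * spinVal (σ' (Fin.castAdd k i))
      set b := ∑ i, spinVal (σ (Fin.natAdd m i)) * spinVal (σ' (Fin.natAdd m i))
      have : (a + b) ^ 2 / (m + k) ≤ a ^ 2 / m + b ^ 2 / k := by
        have : a ^ 2 / m + b ^ 2 / k - (a + b) ^ 2 / (m + k)
            = (a * k - b * m) ^ 2 / (m * k * (m + k)) := by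
          field_simp
          ring
        have : (0 : ℝ) ≤ (a * k - b * m) ^ 2 / (m * k * (m + k)) := by positivity
        linarith
      nlinarith [sq_nonneg β])
    h0 h1
  simp only [skMuJ, skZ_eq_boltzmannSum]
  refine le_trans (le_of_eq ?_) key
  have hmp := measurePreserving_sumPiEquivProdPi
    (fun _ : (Fin m × Fin m) ⊕ (Fin k × Fin k) => gaussianReal 0 1)
  rw [← integral_prod_mul]
  refine (hmp.integral_comp' _).symm.trans ?_
  refine integral_congr_ae (Eventually.of_forall fun g => ?_)
  simp only
  rw [← mul_rpow (boltzmannSum_one_pos _ _ _).le (boltzmannSum_one_pos _ _ _).le]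
  congr 1
  simp only [boltzmannSum]
  rw [Finset.sum_mul_sum, ← Fintype.sum_prod_type',
    ← (Fin.appendEquiv (α := Bool) m k).sum_comp]
  refine Finset.sum_congr rfl fun p _ => ?_
  simp only [Pi.one_apply, one_mul]
  rw [← exp_add]
  congr 1
  have e1 : (Fin.appendEquiv m k p) ∘ Fin.castAdd k = p.1 := by
    ext i; simp [Fin.appendEquiv]
  have e2 : (Fin.appendEquiv m k p) ∘ Fin.natAdd m = p.2 := by
    ext i; simp [Fin.appendEquiv]
  have e3 : skField (m + k) β h (Fin.appendEquiv m k p)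
      = skField m β h p.1 + skField k β h p.2 := by
    rw [skField, Fin.sum_univ_add, ← e1, ← e2]
    simp only [skField, Function.comp_apply]
    ring
  rw [e3, Fintype.sum_sum_type]
  simp only [Sum.elim_inl, Sum.elim_inr, e1, e2]
  simp only [MeasurableEquiv.sumPiEquivProdPi, MeasurableEquiv.coe_mk, Equiv.sumPiEquivProdPi_apply]
  ring

lemma abs_log_boltzmannSum_sub_le {ι S : Type*} [Fintype ι] [Fintype S] [Nonempty S] (c : S → ℝ)
    {w : ι → S → ℝ} {l : ι → ℝ} (hl : ∀ i s, |w i s| ≤ l i) (x y : ι → ℝ) :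
    |log (boltzmannSum c w 1 x) - log (boltzmannSum c w 1 y)| ≤ ∑ i, l i * |x i - y i| := by
  have key : ∀ x y : ι → ℝ, log (boltzmannSum c w 1 x) - log (boltzmannSum c w 1 y)
      ≤ ∑ i, l i * |x i - y i| := fun x y => by
    have hle : boltzmannSum c w 1 x ≤ exp (∑ i, l i * |x i - y i|) * boltzmannSum c w 1 y := by
      unfold boltzmannSum
      rw [Finset.mul_sum]
      refine Finset.sum_le_sum fun s _ => ?_
      rw [Pi.one_apply, one_mul, one_mul, ← exp_add]
      refine exp_le_exp.2 ?_
      have : ∑ i, w i s * x i ≤ ∑ i, (l i * |x i - y i| + w i s * y i) := by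
        refine Finset.sum_le_sum fun i _ => ?_
        have h1 := le_abs_self (w i s * (x i - y i))
        rw [abs_mul] at h1
        have h2 := mul_le_mul_of_nonneg_right (hl i s) (abs_nonneg (x i - y i))
        linarith
      rw [Finset.sum_add_distrib] at this
      linarith
    have := log_le_log (boltzmannSum_one_pos c w x) hle
    rw [log_mul (exp_pos _).ne' (boltzmannSum_one_pos c w y).ne', log_exp] at this
    linarith
  refine abs_sub_le_iff.2 ⟨key x y, ?_⟩
  simpa only [abs_sub_comm] using key y x

lemma abs_skCoef_le {N : ℕ} {β : ℝ} (hβ : 0 ≤ β) (p : Fin N × Fin N) (σ : Fin N → Bool) :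
    |skCoef N β p σ| ≤ β / √N := by
  unfold skCoef
  split_ifs
  · rw [abs_mul, abs_mul, abs_spinVal, abs_spinVal, abs_of_nonneg (by positivity)]
    simp
  · simp only [abs_zero]; positivity

lemma abs_mul_log_skZ_sub_le {N : ℕ} {β n : ℝ} (h : ℝ) (hβ : 0 ≤ β) (hn : 0 ≤ n)
    (x y : Fin N × Fin N → ℝ) :
    |n * log (skZ N β h x) - n * log (skZ N β h y)|
      ≤ ∑ p : Fin N × Fin N, n * (β / √N) * |x p - y p| := by
  have := abs_log_boltzmannSum_sub_le (skField N β h) (abs_skCoef_le (N := N) hβ) x y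
  rw [← skZ_eq_boltzmannSum, ← skZ_eq_boltzmannSum] at this
  simp only [mul_assoc n]
  rw [← Finset.mul_sum, ← mul_sub, abs_mul, abs_of_nonneg hn]
  exact mul_le_mul_of_nonneg_left this hn

lemma skZ_rpow_eq_exp (N : ℕ) (β h n : ℝ) (J : Fin N × Fin N → ℝ) :
    skZ N β h J ^ n = exp (n * log (skZ N β h J)) := by
  rw [rpow_def_of_pos (skZ_pos N β h J), mul_comm]

lemma integral_skZ_rpow_pos (N : ℕ) {β n : ℝ} (h : ℝ) (hβ : 0 ≤ β) (hn : 0 ≤ n) :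
    0 < ∫ J, skZ N β h J ^ n ∂skMuJ N := by
  simp_rw [skZ_rpow_eq_exp]
  exact integral_exp_pos (μ := stdGaussianPi (Fin N × Fin N))
    (integrable_exp_of_coord_lipschitz (abs_mul_log_skZ_sub_le h hβ hn) fun _ => by positivity)

lemma skPhi_superadditive {m k : ℕ} (hm : m ≠ 0) (hk : k ≠ 0) {β n : ℝ} (h : ℝ) (hβ : 0 ≤ β)
    (hn : n ∈ Set.Ioc (0 : ℝ) 1) :
    m * skPhi m n β h + k * skPhi k n β h ≤ (m + k) * skPhi (m + k) n β h := by
  have hn0 := hn.1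
  have hm' : (0 : ℝ) < m := by positivity
  have hk' : (0 : ℝ) < k := by positivity
  have hpm := integral_skZ_rpow_pos m h hβ hn0.le
  have hpk := integral_skZ_rpow_pos k h hβ hn0.le
  have hlog := log_le_log (mul_pos hpm hpk) (integral_skZ_rpow_mul_le hm hk β h hn0.le hn.2)
  rw [log_mul hpm.ne' hpk.ne'] at hlog
  have e : ∀ N x : ℝ, 0 < N → N * (1 / (N * n) * x) = x / n := fun N x hN => by field_simp
  unfold skPhi
  rw [e _ _ hm', e _ _ hk', Nat.cast_add, e _ _ (add_pos hm' hk'), ← add_div]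
  exact div_le_div_of_nonneg_right hlog hn0.le

/-- Quantitative comparison of the interpolating function with the quenched pressure. -/
lemma skAlpha_le_skPhi_and_skPhi_le {N : ℕ} (hN : N ≠ 0) {β n : ℝ} (h : ℝ) (hβ : 0 ≤ β)
    (hn : 0 < n) :
    skAlpha N β h ≤ skPhi N n β h ∧ skPhi N n β h ≤ skAlpha N β h + n * β ^ 2 := by
  have hN' : (0 : ℝ) < N := by positivity
  set F : (Fin N × Fin N → ℝ) → ℝ := fun J => n * log (skZ N β h J)
  have hF : ∀ x y, |F x - F y| ≤ ∑ p : Fin N × Fin N, n * (β / √N) * |x p - y p| :=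
    abs_mul_log_skZ_sub_le h hβ hn.le
  have hl : ∀ p : Fin N × Fin N, 0 ≤ n * (β / √N) := fun _ => by positivity
  have hexp : ∀ J, skZ N β h J ^ n = exp (F J) := skZ_rpow_eq_exp N β h n
  have iF := integrable_of_coord_lipschitz hF hl
  have ieF := integrable_exp_of_coord_lipschitz hF hl
  have upper := integral_exp_le_of_coord_lipschitz hF hl
  have lower : exp (∫ J, F J ∂skMuJ N) ≤ ∫ J, exp (F J) ∂skMuJ N :=
    convexOn_exp.map_integral_le (μ := stdGaussianPi (Fin N × Fin N)) continuous_exp.continuousOn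
      isClosed_univ (by simp) iF ieF
  have hsum : ∑ _p : Fin N × Fin N, (n * (β / √N)) ^ 2 = n ^ 2 * β ^ 2 * N := by
    rw [Finset.sum_const, Finset.card_univ, Fintype.card_prod, Fintype.card_fin, nsmul_eq_mul,
      mul_pow, div_pow, sq_sqrt hN'.le]
    push_cast
    field_simp
  have hFi : ∫ J, F J ∂skMuJ N = n * ∫ J, log (skZ N β h J) ∂skMuJ N := integral_const_mul _ _
  rw [hsum] at upper
  change ∫ J, exp (F J) ∂skMuJ N ≤ exp (∫ J, F J ∂skMuJ N + _) at upper
  have hpos := (exp_pos _).trans_le lower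
  rw [← le_log_iff_exp_le hpos, hFi] at lower
  rw [← log_le_iff_le_exp hpos, hFi] at upper
  unfold skAlpha skPhi
  simp_rw [hexp]
  constructor
  · rw [one_div_mul_eq_div, one_div_mul_eq_div, div_le_div_iff₀ hN' (by positivity)]
    nlinarith
  · rw [one_div_mul_eq_div, one_div_mul_eq_div, ← sub_nonneg]
    have : (∫ J, log (skZ N β h J) ∂skMuJ N) / N + n * β ^ 2
        - log (∫ J, exp (F J) ∂skMuJ N) / (N * n)
        = (n * (∫ J, log (skZ N β h J) ∂skMuJ N) + n ^ 2 * β ^ 2 * N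
          - log (∫ J, exp (F J) ∂skMuJ N)) / (N * n) := by
      field_simp
    rw [this]
    exact div_nonneg (by linarith) (by positivity)

lemma integral_boltzmannSum_one {ι S : Type*} [Fintype ι] [Fintype S] (c : S → ℝ)
    (w : ι → S → ℝ) :
    ∫ g, boltzmannSum c w 1 g ∂stdGaussianPi ι
      = ∑ s, exp (c s + (∑ i, w i s * w i s) / 2) := by
  have e : ∀ s (g : ι → ℝ), (1 : S → ℝ) s * exp (c s + ∑ i, w i s * g i)
      = exp (c s) * ∏ i, exp (w i s * g i) := fun s g => by
    rw [Pi.one_apply, one_mul, exp_add, exp_sum]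
  simp_rw [boltzmannSum, e]
  rw [integral_finsetSum]
  · refine Finset.sum_congr rfl fun s _ => ?_
    rw [integral_const_mul, integral_fintype_prod_eq_prod (𝕜 := ℝ) (fun i x => exp (w i s * x))]
    simp_rw [integral_exp_mul_gaussianReal]
    rw [← exp_sum, ← exp_add, Finset.sum_div]
    simp_rw [sq]
  · intro s _
    exact (Integrable.fintype_prod (f := fun i x => exp (w i s * x))
      fun i => integrable_exp_mul_gaussianReal _).const_mul _

/-- The annealed pressure is bounded uniformly in the volume. -/
lemma skPhi_one_le {N : ℕ} (hN : N ≠ 0) (β h : ℝ) :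
    skPhi N 1 β h ≤ log 2 + |β * h| + β ^ 2 / 4 := by
  have hN' : (0 : ℝ) < N := by positivity
  have hle : ∫ J, skZ N β h J ^ (1 : ℝ) ∂skMuJ N
      ≤ exp (N * (log 2 + |β * h| + β ^ 2 / 4)) := by
    simp_rw [rpow_one, skZ_eq_boltzmannSum]
    change ∫ J, _ ∂stdGaussianPi (Fin N × Fin N) ≤ _
    rw [integral_boltzmannSum_one]
    refine (Finset.sum_le_card_nsmul _ _ (exp (N * (|β * h| + β ^ 2 / 4))) fun σ _ => ?_).trans
      (le_of_eq ?_)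
    · refine exp_le_exp.2 ?_
      rw [sum_skCoef_mul_skCoef hN, sum_spinVal_mul_self]
      have h1 : skField N β h σ ≤ N * |β * h| := by
        refine (le_abs_self _).trans ?_
        rw [skField, abs_mul, mul_comm]
        refine mul_le_mul_of_nonneg_right ((Finset.abs_sum_le_sum_abs _ _).trans ?_)
          (abs_nonneg _)
        simp [abs_spinVal]
      have h2 : (N : ℝ) ^ 2 / N = N := by field_simp
      rw [h2]
      nlinarith [sq_nonneg β]
    · rw [nsmul_eq_mul, Finset.card_univ, Fintype.card_fun, Fintype.card_bool, Fintype.card_fin,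
        add_assoc, mul_add _ (log 2), exp_add, mul_comm (N : ℝ) (log 2), ← rpow_def_of_pos two_pos,
        rpow_natCast]
      push_cast
      rfl
  unfold skPhi
  rw [mul_one, one_div_mul_eq_div, div_le_iff₀ hN', mul_comm _ (N : ℝ)]
  refine (log_le_log ?_ hle).trans_eq (log_exp _)
  simp_rw [rpow_one, skZ_eq_boltzmannSum]
  change 0 < ∫ J, _ ∂stdGaussianPi (Fin N × Fin N)
  rw [integral_boltzmannSum_one]
  exact Finset.sum_pos (fun _ _ => exp_pos _) Finset.univ_nonempty

/-- Fekete's lemma for normalized superadditive sequences. -/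
lemma exists_tendsto_of_superadditive {f : ℕ → ℝ} {B : ℝ}
    (hf : ∀ m k : ℕ, m ≠ 0 → k ≠ 0 → m * f m + k * f k ≤ (m + k) * f (m + k))
    (hB : ∀ N : ℕ, N ≠ 0 → f N ≤ B) : ∃ L, Tendsto f atTop (𝓝 L) := by
  have hsub : Subadditive fun N : ℕ => -(N * f N) := fun m k => by
    rcases eq_or_ne m 0 with rfl | hm
    · simp
    rcases eq_or_ne k 0 with rfl | hk
    · simp
    have := hf m k hm hk
    push_cast
    linarith
  have hdiv : ∀ N : ℕ, N ≠ 0 → -(N * f N) / N = -f N := fun N hN => by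
    have : (N : ℝ) ≠ 0 := by exact_mod_cast hN
    field_simp
  have hbdd : BddBelow (Set.range fun N : ℕ => -(N * f N) / N) := by
    refine ⟨min 0 (-B), ?_⟩
    rintro _ ⟨N, rfl⟩
    rcases eq_or_ne N 0 with rfl | hN
    · simp
    · simp only [hdiv N hN]
      exact (min_le_right _ _).trans (neg_le_neg (hB N hN))
  refine ⟨-hsub.lim, ((hsub.tendsto_lim hbdd).neg).congr' ?_⟩
  filter_upwards [eventually_ne_atTop 0] with N hN
  rw [hdiv N hN, neg_neg]

/-- the zero-replica limit and the infinite-volume limit of the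
interpolating function commute: both iterated limits exist and
`lim_{N→∞} lim_{n→0⁺} φ_N(n,β,h) = lim_{n→0⁺} lim_{N→∞} φ_N(n,β,h) = α(β,h)`,
where `α(β,h) = lim_{N→∞} α_N(β,h)`. -/
theorem stmt19 (β h : ℝ) (hβ : 0 < β) :
    ∃ A : ℝ,
      -- `α(β,h)` is the infinite-volume limit of the quenched pressure
      Tendsto (fun N => skAlpha N β h) atTop (𝓝 A) ∧
      -- for each `N ≥ 1` the zero-replica limit of `φ_N` exists and equals `α_N`,
      -- hence `lim_{N→∞} lim_{n→0⁺} φ_N(n,β,h) = A`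
      (∀ N : ℕ, 1 ≤ N →
        Tendsto (fun n => skPhi N n β h) (𝓝[>] (0:ℝ)) (𝓝 (skAlpha N β h))) ∧
      -- the infinite-volume limit `Φ(n) = lim_{N→∞} φ_N(n,β,h)` exists for each
      -- `n ∈ (0,1]`, and `lim_{n→0⁺} Φ(n) = A`
      ∃ Φ : ℝ → ℝ,
        (∀ n ∈ Set.Ioc (0:ℝ) 1,
          Tendsto (fun N => skPhi N n β h) atTop (𝓝 (Φ n))) ∧
        Tendsto Φ (𝓝[>] (0:ℝ)) (𝓝 A) := by
  have sandwich : ∀ N : ℕ, N ≠ 0 → ∀ n : ℝ, 0 < n →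
      skAlpha N β h ≤ skPhi N n β h ∧ skPhi N n β h ≤ skAlpha N β h + n * β ^ 2 :=
    fun N hN n hn => skAlpha_le_skPhi_and_skPhi_le hN h hβ.le hn
  have hlin : ∀ a : ℝ, Tendsto (fun n : ℝ => a + n * β ^ 2) (𝓝[>] (0 : ℝ)) (𝓝 a) := fun a => by
    have hc : Continuous fun n : ℝ => a + n * β ^ 2 := by fun_prop
    simpa using (hc.tendsto 0).mono_left nhdsWithin_le_nhds
  have hzero : ∀ N : ℕ, N ≠ 0 →
      Tendsto (fun n => skPhi N n β h) (𝓝[>] (0 : ℝ)) (𝓝 (skAlpha N β h)) := fun N hN =>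
    tendsto_of_tendsto_of_tendsto_of_le_of_le' tendsto_const_nhds (hlin _)
      (eventually_mem_nhdsWithin.mono fun n hn => (sandwich N hN n hn).1)
      (eventually_mem_nhdsWithin.mono fun n hn => (sandwich N hN n hn).2)
  have halpha : ∀ N : ℕ, N ≠ 0 → skAlpha N β h ≤ log 2 + |β * h| + β ^ 2 / 4 := fun N hN =>
    (sandwich N hN 1 one_pos).1.trans (skPhi_one_le hN β h)
  have hIoc : ∀ᶠ n in 𝓝[>] (0 : ℝ), n ∈ Set.Ioc (0 : ℝ) 1 := Ioc_mem_nhdsGT one_pos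
  obtain ⟨A, hA⟩ : ∃ A, Tendsto (fun N => skAlpha N β h) atTop (𝓝 A) := by
    refine exists_tendsto_of_superadditive (fun m k hm hk => ?_) halpha
    exact le_of_tendsto_of_tendsto (((hzero m hm).const_mul _).add ((hzero k hk).const_mul _))
      ((hzero (m + k) (by omega)).const_mul _)
      (hIoc.mono fun n hn => skPhi_superadditive hm hk h hβ.le hn)
  have hPhi : ∀ n : ℝ, ∃ L : ℝ, n ∈ Set.Ioc (0 : ℝ) 1 →
      Tendsto (fun N => skPhi N n β h) atTop (𝓝 L) := fun n => by
    by_cases hn : n ∈ Set.Ioc (0 : ℝ) 1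
    · obtain ⟨L, hL⟩ := exists_tendsto_of_superadditive (f := fun N => skPhi N n β h)
        (fun m k hm hk => skPhi_superadditive hm hk h hβ.le hn)
        (fun N hN => (sandwich N hN n hn.1).2.trans (add_le_add_left (halpha N hN) _))
      exact ⟨L, fun _ => hL⟩
    · exact ⟨0, fun h => absurd h hn⟩
  choose Φ hΦ using hPhi
  refine ⟨A, hA, fun N hN => hzero N (by omega), Φ, hΦ, ?_⟩
  refine tendsto_of_tendsto_of_tendsto_of_le_of_le' tendsto_const_nhds (hlin A)
    (hIoc.mono fun n hn => ?_) (hIoc.mono fun n hn => ?_)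
  · exact le_of_tendsto_of_tendsto hA (hΦ n hn)
      ((eventually_ne_atTop 0).mono fun N hN => (sandwich N hN n hn.1).1)
  · exact le_of_tendsto_of_tendsto (hΦ n hn) (hA.add_const _)
      ((eventually_ne_atTop 0).mono fun N hN => (sandwich N hN n hn.1).2)
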